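/- Let Γ1 and Γ2 be plane cubic curves in ℙ²(ℂ) (zero sets of nonzero homogeneous polynomials of degree 3 in three variables) whose set-theoretic intersection Γ1 ∩ Γ2 consists of exactly nine distinct points P1, …, P9. If Γ is another plane cubic curve containing the eight points P1, …, P8, then Γ also contains P9. -/

import Mathlib

noncomputable section

namespace PappusPaper

/-- A representative vector of homogeneous coordinates: a point (or a line,
via its coefficient vector) of `ℙ²(ℂ)` is a nonzero `v : Fin 3 → ℂ` up to scalar. -/
abbrev Pt : Type := Fin 3 → ℂ

/-- Cross product: coefficient vector of the line through two points,
and likewise a representative of the intersection point of two lines. -/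
def cp (p q : Pt) : Pt :=
  ![p 1 * q 2 - p 2 * q 1, p 2 * q 0 - p 0 * q 2, p 0 * q 1 - p 1 * q 0]

/-- The point `p = (p 0 : p 1 : p 2)` lies on the line `l 0 * x + l 1 * y + l 2 * z = 0`. -/
def onL (l p : Pt) : Prop := l 0 * p 0 + l 1 * p 1 + l 2 * p 2 = 0

/-- `p` and `q` represent the same projective point (resp. the same line). -/
def projEq (p q : Pt) : Prop := ∃ t : ℂ, t ≠ 0 ∧ q = t • p

/-- Determinant of the 3×3 matrix whose columns are `p`, `q`, `r`. -/
def det3 (p q r : Pt) : ℂ :=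
  p 0 * (q 1 * r 2 - q 2 * r 1) - p 1 * (q 0 * r 2 - q 2 * r 0) +
    p 2 * (q 0 * r 1 - q 1 * r 0)

/-- Three points lie on a common line. -/
def Collin (p q r : Pt) : Prop := ∃ l : Pt, l ≠ 0 ∧ onL l p ∧ onL l q ∧ onL l r

/-- The cross-ratio `[A,B;C,D]` of four collinear points, computed from an
auxiliary point `O` not on their common line. -/
def crossRatio (O A B C D : Pt) : ℂ :=
  (det3 O A C * det3 O B D) / (det3 O A D * det3 O B C)

/-- The points `A1 = (1:0:0)`, `A2 = (1:a:0)`, `A3 = (0:1:0)` (0-indexed). -/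
def ptA (a : ℂ) : Fin 3 → Pt := ![![1, 0, 0], ![1, a, 0], ![0, 1, 0]]

/-- The points `B1 = (1:1:b)`, `B2 = (0:0:1)`, `B3 = (1:1:1)` (0-indexed). -/
def ptB (b : ℂ) : Fin 3 → Pt := ![![1, 1, b], ![0, 0, 1], ![1, 1, 1]]

/-- The line `L_A : z = 0`. -/
def lineA : Pt := ![0, 0, 1]

/-- The line `L_B : x - y = 0`. -/
def lineB : Pt := ![1, -1, 0]

/-- The intersection point `S = (1:1:0)` of `L_A` and `L_B`. -/
def Spt : Pt := ![1, 1, 0]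

/-- Given a triple `P` of points on one line and a triple `Q` of points on another
line, and a permutation `σ` of indices, the three Pappus intersection points
`C_{1,σ} = L(P2,Q_{σ(3)}) ∩ L(P3,Q_{σ(2)})`, `C_{2,σ} = L(P1,Q_{σ(3)}) ∩ L(P3,Q_{σ(1)})`,
`C_{3,σ} = L(P1,Q_{σ(2)}) ∩ L(P2,Q_{σ(1)})` (0-indexed). -/
def pappusC (P Q : Fin 3 → Pt) (σ : Fin 3 → Fin 3) : Fin 3 → Pt :=
  ![cp (cp (P 1) (Q (σ 2))) (cp (P 2) (Q (σ 1))),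
    cp (cp (P 0) (Q (σ 2))) (cp (P 2) (Q (σ 0))),
    cp (cp (P 0) (Q (σ 1))) (cp (P 1) (Q (σ 0)))]

/-- The Pappus line: the line through the (collinear) points
`C_{1,σ}` and `C_{2,σ}`. -/
def pappusLine (P Q : Fin 3 → Pt) (σ : Fin 3 → Fin 3) : Pt :=
  cp (pappusC P Q σ 0) (pappusC P Q σ 1)

/-- The points `C_{1,σ}, C_{2,σ}, C_{3,σ}` of the fixed configuration (0-indexed). -/
def Cpt (a b : ℂ) (σ : Fin 3 → Fin 3) : Fin 3 → Pt := pappusC (ptA a) (ptB b) σ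

/-- The Pappus line `L_{C,σ}` of the fixed configuration. -/
def LC (a b : ℂ) (σ : Fin 3 → Fin 3) : Pt := pappusLine (ptA a) (ptB b) σ

/-- The identity permutation of `{1,2,3}` (0-indexed, as a function). -/
def pid : Fin 3 → Fin 3 := ![0, 1, 2]
/-- `τ₂ = (1↦2, 2↦1, 3↦3)` (0-indexed, as a function). -/
def tau2 : Fin 3 → Fin 3 := ![1, 0, 2]
/-- `τ₃ = (1↦3, 2↦1, 3↦2)` (0-indexed, as a function). -/
def tau3 : Fin 3 → Fin 3 := ![2, 0, 1]
/-- `τ₃² = (1↦2, 2↦3, 3↦1)` (0-indexed, as a function). -/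
def tau3sq : Fin 3 → Fin 3 := ![1, 2, 0]
/-- `τ₂τ₃ = (1↦3, 2↦2, 3↦1)` (0-indexed, as a function). -/
def tau2tau3 : Fin 3 → Fin 3 := ![2, 1, 0]
/-- `τ₂τ₃² = (1↦1, 2↦3, 3↦2)` (0-indexed, as a function). -/
def tau2tau3sq : Fin 3 → Fin 3 := ![0, 2, 1]

/-- The line `M1 : (ab−b+1)x + a(ab−a+1)y + a(b²−b+1)z = 0` of the dual plane. -/
def M1 (a b : ℂ) : Pt := ![a * b - b + 1, a * (a * b - a + 1), a * (b ^ 2 - b + 1)]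

/-- The line `M2 : (a+b−1)x + a(a+b−ab)y + a(b²−b+1)z = 0` of the dual plane. -/
def M2 (a b : ℂ) : Pt := ![a + b - 1, a * (a + b - a * b), a * (b ^ 2 - b + 1)]

/-- The dual points of the three even Pappus lines `L_{C,id}, L_{C,τ₃}, L_{C,τ₃²}`,
lying on `M1`. -/
def Ppts (a b : ℂ) : Fin 3 → Pt := ![LC a b pid, LC a b tau3, LC a b tau3sq]

/-- The dual points of the three odd Pappus lines `L_{C,τ₂}, L_{C,τ₂τ₃}, L_{C,τ₂τ₃²}`,
lying on `M2`. -/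
def Qpts (a b : ℂ) : Fin 3 → Pt := ![LC a b tau2, LC a b tau2tau3, LC a b tau2tau3sq]

/-- The Pappus line `N_σ` of the dual configuration, obtained by applying the Pappus
construction in the dual plane to the two triples of dual points of the Pappus lines;
its coordinate vector is also a representative of its dual point `N_σ*` in the
original plane. -/
def Nline (a b : ℂ) (σ : Fin 3 → Fin 3) : Pt := pappusLine (Ppts a b) (Qpts a b) σ

/-! ### Restricting forms to parametrized curves -/

theorem aux_deg {n k : ℕ} (F : MvPolynomial (Fin 3) ℂ) (hF : F.IsHomogeneous n)
    (v : Fin 3 → Polynomial ℂ) (hv : ∀ i, (v i).natDegree ≤ k) :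
    (MvPolynomial.aeval v F).natDegree ≤ n * k :=
  MvPolynomial.aeval_natDegree_le F hF.totalDegree_le v hv

theorem aux_lead {n k : ℕ} (F : MvPolynomial (Fin 3) ℂ) (hF : F.IsHomogeneous n)
    (v : Fin 3 → Polynomial ℂ) (hv : ∀ i, (v i).natDegree ≤ k) :
    (MvPolynomial.aeval v F).coeff (n * k)
      = MvPolynomial.eval (fun i => (v i).coeff k) F := by
  rw [MvPolynomial.aeval_def, MvPolynomial.eval₂_eq', MvPolynomial.eval_eq',
    Polynomial.finsetSum_coeff]
  refine Finset.sum_congr rfl fun d hd => ?_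
  have hdeg : ∑ i, d i = n := by
    have := hF (MvPolynomial.mem_support_iff.mp hd)
    rw [← this, Finsupp.weight_apply, Finsupp.sum_fintype] <;> simp
  rw [Polynomial.algebraMap_eq, Polynomial.coeff_C_mul]
  congr 1
  rw [Fin.prod_univ_three, Fin.prod_univ_three]
  have hs : n * k = d 0 * k + d 1 * k + d 2 * k := by
    rw [← hdeg, Fin.sum_univ_three]; ring
  have hp : ∀ i, (v i ^ d i).natDegree ≤ d i * k := fun i =>
    Polynomial.natDegree_pow_le_of_le _ (hv i)
  rw [hs, Polynomial.coeff_mul_add_eq_of_natDegree_le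
    (Polynomial.natDegree_mul_le_of_le (hp 0) (hp 1)) (hp 2),
    Polynomial.coeff_mul_add_eq_of_natDegree_le (hp 0) (hp 1),
    Polynomial.coeff_pow_of_natDegree_le (hv 0),
    Polynomial.coeff_pow_of_natDegree_le (hv 1), Polynomial.coeff_pow_of_natDegree_le (hv 2)]

theorem aux_eval (F : MvPolynomial (Fin 3) ℂ) (v : Fin 3 → Polynomial ℂ) (t : ℂ) :
    (MvPolynomial.aeval v F).eval t = MvPolynomial.eval (fun i => (v i).eval t) F := by
  induction F using MvPolynomial.induction_on with
  | C a => simp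
  | add p q hp hq => simp [hp, hq]
  | mul_X p i hp => simp [hp]

theorem aux_scale {n : ℕ} (F : MvPolynomial (Fin 3) ℂ) (hF : F.IsHomogeneous n)
    (c : ℂ) (v : Pt) : MvPolynomial.eval (c • v) F = c ^ n * MvPolynomial.eval v F := by
  rw [MvPolynomial.eval_eq', MvPolynomial.eval_eq', Finset.mul_sum]
  refine Finset.sum_congr rfl fun d hd => ?_
  have hdeg : ∑ i, d i = n := by
    have := hF (MvPolynomial.mem_support_iff.mp hd)
    rw [← this, Finsupp.weight_apply, Finsupp.sum_fintype] <;> simp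
  rw [← hdeg]
  simp only [Fin.prod_univ_three, Fin.sum_univ_three, Pi.smul_apply, smul_eq_mul]
  ring

/-- A form of degree `n` with too many zeros on a curve parametrized in degree `k`
(one of them at infinity) vanishes on the curve. -/
theorem aux_vanish {n k : ℕ} (F : MvPolynomial (Fin 3) ℂ) (hF : F.IsHomogeneous n)
    (v : Fin 3 → Polynomial ℂ) (hv : ∀ i, (v i).natDegree ≤ k)
    (S : Finset ℂ) (hS : n * k ≤ S.card)
    (hz : ∀ s ∈ S, MvPolynomial.eval (fun i => (v i).eval s) F = 0)
    (hl : MvPolynomial.eval (fun i => (v i).coeff k) F = 0) (t : ℂ) :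
    MvPolynomial.eval (fun i => (v i).eval t) F = 0 := by
  have hd := aux_deg F hF v hv
  have hc := aux_lead F hF v hv
  rw [hl] at hc
  have : MvPolynomial.aeval v F = 0 := by
    by_contra hne
    have hlt : (MvPolynomial.aeval v F).natDegree < n * k := by
      refine lt_of_le_of_ne hd fun h => ?_
      rw [← h] at hc
      exact hne (Polynomial.leadingCoeff_eq_zero.mp hc)
    apply hne
    apply Polynomial.eq_zero_of_natDegree_lt_card_of_eval_eq_zero' _ S
    · intro s hs
      rw [aux_eval]; exact hz s hs
    · omega
  rw [← aux_eval, this, Polynomial.eval_zero]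

/-- The nine points cannot exhaust an infinite family of common zeros. -/
theorem aux_pigeon (F G : MvPolynomial (Fin 3) ℂ) (P : Fin 9 → Pt)
    (hint : ∀ v : Pt, v ≠ 0 →
      ((MvPolynomial.eval v F = 0 ∧ MvPolynomial.eval v G = 0) ↔ ∃ i, projEq (P i) v))
    {ι : Type} [Infinite ι] (w : ι → Pt) (hw0 : ∀ s, w s ≠ 0)
    (hF : ∀ s, MvPolynomial.eval (w s) F = 0) (hG : ∀ s, MvPolynomial.eval (w s) G = 0)
    (hw : ∀ s t, ∀ c : ℂ, w s = c • w t → s = t) : False := by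
  choose i hi using fun s => (hint (w s) (hw0 s)).mp ⟨hF s, hG s⟩
  obtain ⟨s, t, hst, h⟩ := Finite.exists_ne_map_eq_of_infinite i
  obtain ⟨a, ha, has⟩ := hi s
  obtain ⟨b, hb, hbt⟩ := hi t
  apply hst
  apply hw s t (a / b)
  rw [has, hbt, h, smul_smul]
  congr 1
  field_simp

/-! ### Linear algebra in `ℂ³` -/

theorem det3_comb (p q r : Pt) (h : det3 p q r ≠ 0) (a b c : ℂ)
    (h0 : a • p + b • q + c • r = 0) : a = 0 ∧ b = 0 ∧ c = 0 := by
  have e0 := congrFun h0 0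
  have e1 := congrFun h0 1
  have e2 := congrFun h0 2
  simp only [Pi.add_apply, Pi.smul_apply, smul_eq_mul, Pi.zero_apply] at e0 e1 e2
  refine ⟨?_, ?_, ?_⟩
  · refine (mul_eq_zero.mp (?_ : a * det3 p q r = 0)).resolve_right h
    unfold det3
    linear_combination (q 1 * r 2 - q 2 * r 1) * e0 - (q 0 * r 2 - q 2 * r 0) * e1
      + (q 0 * r 1 - q 1 * r 0) * e2
  · refine (mul_eq_zero.mp (?_ : b * det3 p q r = 0)).resolve_right h
    unfold det3
    linear_combination -(p 1 * r 2 - p 2 * r 1) * e0 + (p 0 * r 2 - p 2 * r 0) * e1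
      - (p 0 * r 1 - p 1 * r 0) * e2
  · refine (mul_eq_zero.mp (?_ : c * det3 p q r = 0)).resolve_right h
    unfold det3
    linear_combination (p 1 * q 2 - p 2 * q 1) * e0 - (p 0 * q 2 - p 2 * q 0) * e1
      + (p 0 * q 1 - p 1 * q 0) * e2

theorem det3_span (p q r : Pt) (h : det3 p q r ≠ 0) (x : Pt) :
    ∃ a b c : ℂ, x = a • p + b • q + c • r := by
  refine ⟨det3 x q r / det3 p q r, det3 p x r / det3 p q r, det3 p q x / det3 p q r, ?_⟩
  ext i
  simp only [Pi.add_apply, Pi.smul_apply, smul_eq_mul]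
  rw [div_mul_eq_mul_div, div_mul_eq_mul_div, div_mul_eq_mul_div, ← add_div, ← add_div,
    eq_div_iff h]
  unfold det3
  fin_cases i <;> simp <;> ring

theorem det3_zero (p q r : Pt) (hp : p ≠ 0) (hq : q ≠ 0) (hpq : ¬ projEq p q)
    (h : det3 p q r = 0) : ∃ a b : ℂ, r = a • p + b • q := by
  unfold det3 at h
  by_cases h2 : p 0 * q 1 - p 1 * q 0 = 0
  · by_cases h1 : p 0 * q 2 - p 2 * q 0 = 0
    · by_cases h0 : p 1 * q 2 - p 2 * q 1 = 0
      · exfalso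
        apply hpq
        have : ∃ i, p i ≠ 0 := by
          by_contra hc; push Not at hc; exact hp (funext hc)
        obtain ⟨i, hi⟩ := this
        have hqe : q = (q i / p i) • p := by
          ext j
          simp only [Pi.smul_apply, smul_eq_mul]
          field_simp
          fin_cases i <;> fin_cases j <;> simp <;> first
            | ring1
            | linear_combination h0
            | linear_combination -h0
            | linear_combination h1
            | linear_combination -h1
            | linear_combination h2
            | linear_combination -h2
        refine ⟨q i / p i, fun hz => hq ?_, hqe⟩
        rw [hqe, hz, zero_smul]
      · refine ⟨(r 1 * q 2 - r 2 * q 1) / (p 1 * q 2 - p 2 * q 1),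
          (p 1 * r 2 - p 2 * r 1) / (p 1 * q 2 - p 2 * q 1), ?_⟩
        ext j
        simp only [Pi.add_apply, Pi.smul_apply, smul_eq_mul]
        rw [div_mul_eq_mul_div, div_mul_eq_mul_div, ← add_div, eq_div_iff h0]
        fin_cases j <;> simp
        · linear_combination h
        · ring
        · ring
    · refine ⟨(r 0 * q 2 - r 2 * q 0) / (p 0 * q 2 - p 2 * q 0),
          (p 0 * r 2 - p 2 * r 0) / (p 0 * q 2 - p 2 * q 0), ?_⟩
      ext j
      simp only [Pi.add_apply, Pi.smul_apply, smul_eq_mul]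
      rw [div_mul_eq_mul_div, div_mul_eq_mul_div, ← add_div, eq_div_iff h1]
      fin_cases j <;> simp
      · ring
      · linear_combination -h
      · ring
  · refine ⟨(r 0 * q 1 - r 1 * q 0) / (p 0 * q 1 - p 1 * q 0),
          (p 0 * r 1 - p 1 * r 0) / (p 0 * q 1 - p 1 * q 0), ?_⟩
    ext j
    simp only [Pi.add_apply, Pi.smul_apply, smul_eq_mul]
    rw [div_mul_eq_mul_div, div_mul_eq_mul_div, ← add_div, eq_div_iff h2]
    fin_cases j <;> simp
    · ring
    · ring
    · linear_combination h

theorem not_projEq_smul {p q : Pt} (hq : q ≠ 0) (h : ¬ projEq p q) (c : ℂ) : q ≠ c • p := by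
  intro hc
  refine h ⟨c, fun h0 => hq ?_, hc⟩
  rw [hc, h0, zero_smul]

/-- A pair of distinct points is linearly independent. -/
theorem pair_indep {p q : Pt} (hp : p ≠ 0) (hq : q ≠ 0) (h : ¬ projEq p q) (a b : ℂ)
    (h0 : a • p + b • q = 0) : a = 0 ∧ b = 0 := by
  have hb : b = 0 := by
    by_contra hb
    apply not_projEq_smul hq h (-a / b)
    have : b • q = (-a) • p := by
      rw [neg_smul]; exact eq_neg_of_add_eq_zero_right h0
    rw [div_eq_inv_mul, mul_smul, ← this, smul_smul, inv_mul_cancel₀ hb, one_smul]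
  subst hb
  rw [zero_smul, add_zero] at h0
  exact ⟨(smul_eq_zero.mp h0).resolve_right hp, rfl⟩

/-- No four of the nine points are collinear. -/
theorem no_four (F G : MvPolynomial (Fin 3) ℂ)
    (hFhom : F.IsHomogeneous 3) (hGhom : G.IsHomogeneous 3)
    (P : Fin 9 → Pt) (hP0 : ∀ i, P i ≠ 0)
    (hPdist : ∀ i j, i ≠ j → ¬ projEq (P i) (P j))
    (hint : ∀ v : Pt, v ≠ 0 →
      ((MvPolynomial.eval v F = 0 ∧ MvPolynomial.eval v G = 0) ↔ ∃ i, projEq (P i) v))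
    (i j k l : Fin 9) (hij : i ≠ j) (hik : i ≠ k) (hil : i ≠ l) (hjk : j ≠ k) (hjl : j ≠ l)
    (hkl : k ≠ l) (h1 : det3 (P i) (P j) (P k) = 0) (h2 : det3 (P i) (P j) (P l) = 0) :
    False := by
  have hPz : ∀ i, MvPolynomial.eval (P i) F = 0 ∧ MvPolynomial.eval (P i) G = 0 := fun i =>
    (hint (P i) (hP0 i)).mpr ⟨i, 1, one_ne_zero, (one_smul _ _).symm⟩
  obtain ⟨a, b, hk⟩ := det3_zero _ _ _ (hP0 i) (hP0 j) (hPdist i j hij) h1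
  obtain ⟨c, d, hl⟩ := det3_zero _ _ _ (hP0 i) (hP0 j) (hPdist i j hij) h2
  have ha : a ≠ 0 := by
    rintro rfl
    apply not_projEq_smul (hP0 k) (hPdist j k hjk) b; rw [hk]; simp
  have hb : b ≠ 0 := by
    rintro rfl
    apply not_projEq_smul (hP0 k) (hPdist i k hik) a; rw [hk]; simp
  have hc : c ≠ 0 := by
    rintro rfl
    apply not_projEq_smul (hP0 l) (hPdist j l hjl) d; rw [hl]; simp
  have hd : d ≠ 0 := by
    rintro rfl
    apply not_projEq_smul (hP0 l) (hPdist i l hil) c; rw [hl]; simp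
  have hbd : b / a ≠ d / c := by
    intro h
    apply not_projEq_smul (hP0 l) (hPdist k l hkl) (c / a)
    have : d = c / a * b := by field_simp at h ⊢; linear_combination -h
    rw [hl, hk, smul_add, smul_smul, smul_smul, ← this, div_mul_cancel₀ _ ha]
  let v : Fin 3 → Polynomial ℂ := fun m => Polynomial.C (P j m) * Polynomial.X + Polynomial.C (P i m)
  have hvd : ∀ m, (v m).natDegree ≤ 1 := fun m => Polynomial.natDegree_linear_le
  have hve : ∀ t, (fun m => (v m).eval t) = P i + t • P j := by
    intro t; ext m; simp [v]; ring
  have hvc : (fun m => (v m).coeff 1) = P j := by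
    ext m; simp [v]
  have key : ∀ E : MvPolynomial (Fin 3) ℂ, E.IsHomogeneous 3 →
      (∀ m, MvPolynomial.eval (P m) E = 0) → ∀ t : ℂ, MvPolynomial.eval (P i + t • P j) E = 0 := by
    intro E hE hz t
    rw [← hve]
    apply aux_vanish E hE v hvd {0, b / a, d / c}
    · rw [Finset.card_eq_three.mpr ⟨0, b / a, d / c, ?_, ?_, hbd, rfl⟩]
      · exact (div_ne_zero hb ha).symm
      · exact (div_ne_zero hd hc).symm
    · intro s hs
      rw [hve]
      simp only [Finset.mem_insert, Finset.mem_singleton] at hs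
      rcases hs with rfl | rfl | rfl
      · simpa using hz i
      · have : P i + (b / a) • P j = a⁻¹ • P k := by
          rw [hk, smul_add, smul_smul, smul_smul, inv_mul_cancel₀ ha, one_smul, div_eq_inv_mul]
        rw [this, aux_scale E hE, hz, mul_zero]
      · have : P i + (d / c) • P j = c⁻¹ • P l := by
          rw [hl, smul_add, smul_smul, smul_smul, inv_mul_cancel₀ hc, one_smul, div_eq_inv_mul]
        rw [this, aux_scale E hE, hz, mul_zero]
    · rw [hvc]; exact hz j
  have ind := pair_indep (hP0 i) (hP0 j) (hPdist i j hij)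
  refine aux_pigeon F G P hint (fun t : ℂ => P i + t • P j) ?_
    (key F hFhom fun m => (hPz m).1) (key G hGhom fun m => (hPz m).2) ?_
  · intro t ht
    have := (ind 1 t (by rw [one_smul]; exact ht)).1
    exact one_ne_zero this
  · intro s t c h
    have := ind (1 - c) (s - c * t) (by
      have h' := sub_eq_zero.mpr h
      rw [← h', sub_smul, sub_smul, one_smul, smul_add, smul_smul]; abel)
    linear_combination this.2 - t * this.1

/-- The zero set of a single cubic form is infinite. -/
theorem not_prop (F G : MvPolynomial (Fin 3) ℂ) (hG : G ≠ 0) (hGhom : G.IsHomogeneous 3)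
    (P : Fin 9 → Pt)
    (hint : ∀ v : Pt, v ≠ 0 →
      ((MvPolynomial.eval v F = 0 ∧ MvPolynomial.eval v G = 0) ↔ ∃ i, projEq (P i) v))
    (c : ℂ) (hFG : F = c • G) : False := by
  obtain ⟨p, hp⟩ : ∃ p : Pt, MvPolynomial.eval p G ≠ 0 := by
    by_contra h
    push Not at h
    exact hG (MvPolynomial.funext fun x => by rw [h x, map_zero])
  have hp0 : p ≠ 0 := by
    rintro rfl
    apply hp
    have := aux_scale G hGhom 0 0
    simpa using this
  obtain ⟨e, f, hd⟩ : ∃ e f : Pt, det3 p e f ≠ 0 := by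
    have : ∃ i, p i ≠ 0 := by
      by_contra hc; push Not at hc; exact hp0 (funext hc)
    obtain ⟨i, hi⟩ := this
    fin_cases i
    · exact ⟨![0, 1, 0], ![0, 0, 1], by simpa [det3] using hi⟩
    · exact ⟨![1, 0, 0], ![0, 0, 1], by simpa [det3] using hi⟩
    · exact ⟨![1, 0, 0], ![0, 1, 0], by simpa [det3] using hi⟩
  have hroot : ∀ s : ℂ, ∃ t : ℂ, MvPolynomial.eval (t • p + (1 : ℂ) • e + s • f) G = 0 := by
    intro s
    let v : Fin 3 → Polynomial ℂ := fun m =>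
      Polynomial.C (p m) * Polynomial.X + Polynomial.C (e m + s * f m)
    have hvd : ∀ m, (v m).natDegree ≤ 1 := fun m => Polynomial.natDegree_linear_le
    have hve : ∀ t, (fun m => (v m).eval t) = t • p + (1 : ℂ) • e + s • f := by
      intro t; ext m; simp [v]; ring
    have hvc : (fun m => (v m).coeff 1) = p := by
      ext m; simp [v]
    have hl := aux_lead G hGhom v hvd
    rw [hvc] at hl
    have hdeg : (MvPolynomial.aeval v G).degree ≠ 0 := by
      intro h0
      rw [Polynomial.coeff_eq_zero_of_degree_lt (by rw [h0]; norm_num)] at hl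
      exact hp hl.symm
    obtain ⟨t, ht⟩ := IsAlgClosed.exists_root _ hdeg
    refine ⟨t, ?_⟩
    rw [← hve, ← aux_eval]; exact ht
  choose t ht using hroot
  have ind := det3_comb p e f hd
  refine aux_pigeon F G P hint (fun s : ℂ => t s • p + (1 : ℂ) • e + s • f) ?_ ?_ ht ?_
  · intro s hs
    exact one_ne_zero (ind _ _ _ hs).2.1
  · intro s
    rw [hFG, MvPolynomial.smul_eval, ht, mul_zero]
  · intro s r c h
    have := ind (t s - c * t r) (1 - c) (s - c * r) (by
      have h' := sub_eq_zero.mpr h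
      rw [← h']; simp only [sub_smul, smul_add, mul_smul, one_smul]; abel)
    linear_combination this.2.2 - r * this.2.1

/-! ### Conics -/

/-- The quadratic form with coefficient vector `c`. -/
def cq (c : Fin 6 → ℂ) (v : Pt) : ℂ :=
  c 0 * v 0 ^ 2 + c 1 * v 1 ^ 2 + c 2 * v 2 ^ 2 + c 3 * (v 0 * v 1) + c 4 * (v 0 * v 2)
    + c 5 * (v 1 * v 2)

/-- The polar form of `cq c`. -/
def cb (c : Fin 6 → ℂ) (v w : Pt) : ℂ :=
  2 * c 0 * (v 0 * w 0) + 2 * c 1 * (v 1 * w 1) + 2 * c 2 * (v 2 * w 2)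
    + c 3 * (v 0 * w 1 + v 1 * w 0) + c 4 * (v 0 * w 2 + v 2 * w 0)
    + c 5 * (v 1 * w 2 + v 2 * w 1)

theorem cq_two (c : Fin 6 → ℂ) (p q : Pt) (α β : ℂ) :
    cq c (α • p + β • q) = α ^ 2 * cq c p + β ^ 2 * cq c q + α * β * cb c p q := by
  simp only [cq, cb, Pi.add_apply, Pi.smul_apply, smul_eq_mul]; ring

theorem cq_three (c : Fin 6 → ℂ) (p q r : Pt) (α β γ : ℂ) :
    cq c (α • p + β • q + γ • r) = α ^ 2 * cq c p + β ^ 2 * cq c q + γ ^ 2 * cq c r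
      + α * β * cb c p q + α * γ * cb c p r + β * γ * cb c q r := by
  simp only [cq, cb, Pi.add_apply, Pi.smul_apply, smul_eq_mul]; ring

theorem cq_zero (c : Fin 6 → ℂ) (h : ∀ v, cq c v = 0) : c = 0 := by
  have h0 := h ![1, 0, 0]
  have h1 := h ![0, 1, 0]
  have h2 := h ![0, 0, 1]
  have h3 := h ![1, 1, 0]
  have h4 := h ![1, 0, 1]
  have h5 := h ![0, 1, 1]
  simp [cq] at h0 h1 h2 h3 h4 h5
  ext i
  fin_cases i <;> simp
  · exact h0
  · exact h1
  · exact h2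
  · linear_combination h3 - h0 - h1
  · linear_combination h4 - h0 - h2
  · linear_combination h5 - h1 - h2

theorem det3_third (p q r : Pt) (α β γ : ℂ) :
    det3 p q (α • p + β • q + γ • r) = γ * det3 p q r := by
  simp only [det3, Pi.add_apply, Pi.smul_apply, smul_eq_mul]; ring

/-- If a conic contains the line `ab`, its remaining points are collinear. -/
theorem conic_split (c : Fin 6 → ℂ) (hc : c ≠ 0) (a b d e f : Pt)
    (ha : cq c a = 0) (hb : cq c b = 0) (hd : cq c d = 0) (he : cq c e = 0) (hf : cq c f = 0)
    (hab : cb c a b = 0) (h1 : det3 a b d ≠ 0) (h2 : det3 a b e ≠ 0) (h3 : det3 a b f ≠ 0) :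
    det3 d e f = 0 := by
  obtain ⟨α, β, γ, rfl⟩ := det3_span a b d h1 e
  obtain ⟨α', β', γ', rfl⟩ := det3_span a b d h1 f
  rw [det3_third] at h2 h3
  rw [cq_three, ha, hb, hd, hab] at he hf
  have e1 : α * cb c a d + β * cb c b d = 0 := by
    refine (mul_eq_zero.mp (?_ : γ * _ = 0)).resolve_left (left_ne_zero_of_mul h2)
    linear_combination he
  have e2 : α' * cb c a d + β' * cb c b d = 0 := by
    refine (mul_eq_zero.mp (?_ : γ' * _ = 0)).resolve_left (left_ne_zero_of_mul h3)
    linear_combination hf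
  have key : α * β' - β * α' = 0 := by
    by_contra hne
    have m0 : cb c a d = 0 := by
      refine (mul_eq_zero.mp (?_ : (α * β' - β * α') * _ = 0)).resolve_left hne
      linear_combination β' * e1 - β * e2
    have n0 : cb c b d = 0 := by
      refine (mul_eq_zero.mp (?_ : (α * β' - β * α') * _ = 0)).resolve_left hne
      linear_combination α * e2 - α' * e1
    apply hc
    apply cq_zero
    intro v
    obtain ⟨x, y, z, rfl⟩ := det3_span a b d h1 v
    rw [cq_three, ha, hb, hd, hab, m0, n0]; ring
  have : det3 d (α • a + β • b + γ • d) (α' • a + β' • b + γ' • d)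
      = (α * β' - β * α') * det3 a b d := by
    simp only [det3, Pi.add_apply, Pi.smul_apply, smul_eq_mul]; ring
  rw [this, key, zero_mul]

/-- Seven points, no four collinear, on a conic: then no three are collinear. -/
theorem no_three (p : Fin 7 → Pt) (hp0 : ∀ i, p i ≠ 0)
    (hdist : ∀ i j, i ≠ j → ¬ projEq (p i) (p j))
    (h4 : ∀ i j k l, i ≠ j → i ≠ k → i ≠ l → j ≠ k → j ≠ l → k ≠ l →
      det3 (p i) (p j) (p k) = 0 → det3 (p i) (p j) (p l) = 0 → False)
    (c : Fin 6 → ℂ) (hc : c ≠ 0) (hz : ∀ i, cq c (p i) = 0)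
    (i j k : Fin 7) (hij : i ≠ j) (hik : i ≠ k) (hjk : j ≠ k) :
    det3 (p i) (p j) (p k) ≠ 0 := by
  intro h0
  obtain ⟨α, β, hk⟩ := det3_zero _ _ _ (hp0 i) (hp0 j) (hdist i j hij) h0
  have hα : α ≠ 0 := by
    rintro rfl
    apply not_projEq_smul (hp0 k) (hdist j k hjk) β; rw [hk]; simp
  have hβ : β ≠ 0 := by
    rintro rfl
    apply not_projEq_smul (hp0 k) (hdist i k hik) α; rw [hk]; simp
  have hab : cb c (p i) (p j) = 0 := by
    have := hz k
    rw [hk, cq_two, hz i, hz j] at this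
    simpa [hα, hβ] using this
  have hcard : (Finset.univ \ {i, j, k} : Finset (Fin 7)).card = 4 := by
    rw [Finset.card_univ_sdiff, Finset.card_eq_three.mpr ⟨i, j, k, hij, hik, hjk, rfl⟩]; rfl
  let e := Finset.orderEmbOfFin _ hcard
  have he : ∀ m, e m ≠ i ∧ e m ≠ j ∧ e m ≠ k := by
    intro m
    have := Finset.orderEmbOfFin_mem _ hcard m
    rw [Finset.mem_sdiff] at this
    simpa [e] using this.2
  have hne : ∀ m, det3 (p i) (p j) (p (e m)) ≠ 0 := fun m hm =>
    h4 i j k (e m) hij hik (he m).1.symm hjk (he m).2.1.symm (he m).2.2.symm h0 hm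
  have hs : ∀ m, det3 (p (e 0)) (p (e 1)) (p (e m)) = 0 := fun m =>
    conic_split c hc _ _ _ _ _ (hz i) (hz j) (hz _) (hz _) (hz _) hab (hne 0) (hne 1) (hne m)
  have inj : ∀ a b, a ≠ b → e a ≠ e b := fun a b hab h => hab (e.injective h)
  exact h4 (e 0) (e 1) (e 2) (e 3) (inj _ _ (by decide)) (inj _ _ (by decide))
    (inj _ _ (by decide)) (inj _ _ (by decide)) (inj _ _ (by decide)) (inj _ _ (by decide))
    (hs 2) (hs 3)

/-- Parametrization of a conic through three coordinate points, in coordinates. -/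
theorem param_point (x a b q : Pt) (α β γ u v w : ℂ) (hβ : β ≠ 0) (hγ : γ ≠ 0) (hw : w ≠ 0)
    (hq : q = α • x + β • a + γ • b) (h : α * β * u + α * γ * v + β * γ * w = 0) :
    u + γ / β * v ≠ 0 ∧ 
    (-(γ / β * w)) • x + (u + γ / β * v) • a + (γ / β * (u + γ / β * v)) • b
      = ((u + γ / β * v) / β) • q := by
  have h1 : u + γ / β * v ≠ 0 := by
    intro h1
    have h2 : β * u + γ * v = 0 := by field_simp at h1; linear_combination h1
    have : β * γ * w = 0 := by linear_combination h - α * h2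
    simp [hβ, hγ, hw] at this
  refine ⟨h1, ?_⟩
  rw [hq, smul_add, smul_add, smul_smul, smul_smul, smul_smul]
  congr 2
  · congr 1
    field_simp
    linear_combination -h
  · congr 1
    field_simp
  · field_simp

/-- No seven of the nine points lie on a conic. -/
theorem no_seven (F G : MvPolynomial (Fin 3) ℂ)
    (hFhom : F.IsHomogeneous 3) (hGhom : G.IsHomogeneous 3)
    (P : Fin 9 → Pt) (hP0 : ∀ i, P i ≠ 0)
    (hPdist : ∀ i j, i ≠ j → ¬ projEq (P i) (P j))
    (hint : ∀ v : Pt, v ≠ 0 →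
      ((MvPolynomial.eval v F = 0 ∧ MvPolynomial.eval v G = 0) ↔ ∃ i, projEq (P i) v))
    (σ : Fin 7 → Fin 9) (hσ : Function.Injective σ)
    (c : Fin 6 → ℂ) (hc : c ≠ 0) (hz : ∀ i, cq c (P (σ i)) = 0) : False := by
  have hPz : ∀ i, MvPolynomial.eval (P i) F = 0 ∧ MvPolynomial.eval (P i) G = 0 := fun i =>
    (hint (P i) (hP0 i)).mpr ⟨i, 1, one_ne_zero, (one_smul _ _).symm⟩
  set p : Fin 7 → Pt := fun i => P (σ i) with hp
  have h3 : ∀ i j k : Fin 7, i ≠ j → i ≠ k → j ≠ k → det3 (p i) (p j) (p k) ≠ 0 := by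
    refine no_three p (fun i => hP0 _) (fun i j hij => hPdist _ _ (hσ.ne hij)) ?_ c hc hz
    intro i j k l hij hik hil hjk hjl hkl
    exact no_four F G hFhom hGhom P hP0 hPdist hint (σ i) (σ j) (σ k) (σ l) (hσ.ne hij)
      (hσ.ne hik) (hσ.ne hil) (hσ.ne hjk) (hσ.ne hjl) (hσ.ne hkl)
  have hB : ∀ i j k l m : Fin 7, [i, j, k, l, m].Nodup → cb c (p i) (p j) ≠ 0 := by
    intro i j k l m hnd h0
    simp only [List.nodup_cons, List.mem_cons, List.not_mem_nil, or_false, not_or] at hnd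
    obtain ⟨⟨a1, a2, a3, a4⟩, ⟨a5, a6, a7⟩, ⟨a8, a9⟩, a10, -⟩ := hnd
    exact h3 k l m a8 a9 a10 (conic_split c hc _ _ _ _ _ (hz i) (hz j) (hz k) (hz l) (hz m) h0
      (h3 _ _ _ a1 a2 a5) (h3 _ _ _ a1 a3 a6) (h3 _ _ _ a1 a4 a7))
  have hbas := h3 0 1 2 (by decide) (by decide) (by decide)
  set x := p 0 with hx
  set a := p 1 with ha
  set b := p 2 with hb
  set u := cb c x a with hu
  set v := cb c x b with hv
  set w := cb c a b with hw
  have hu0 : u ≠ 0 := hB 0 1 2 3 4 (by decide)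
  have hv0 : v ≠ 0 := hB 0 2 1 3 4 (by decide)
  have hw0 : w ≠ 0 := hB 1 2 0 3 4 (by decide)
  -- coordinates of the other four points
  have hco : ∀ m : Fin 4, ∃ α β γ : ℂ, p (m.natAdd 3) = α • x + β • a + γ • b := fun m =>
    det3_span x a b hbas _
  choose α β γ hco using hco
  have hge : ∀ m : Fin 4, m.natAdd 3 ≠ (0 : Fin 7) ∧ m.natAdd 3 ≠ (1 : Fin 7) ∧
      m.natAdd 3 ≠ (2 : Fin 7) := by decide
  have hγ : ∀ m, γ m ≠ 0 := by
    intro m h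
    apply h3 0 1 (m.natAdd 3) (by decide) (hge m).1.symm (hge m).2.1.symm
    rw [hco, det3_third, h, zero_mul]
  have hβ : ∀ m, β m ≠ 0 := by
    intro m h
    apply h3 0 2 (m.natAdd 3) (by decide) (hge m).1.symm (hge m).2.2.symm
    rw [hco, h]
    simp only [det3, Pi.add_apply, Pi.smul_apply, smul_eq_mul]; ring
  have hcon : ∀ m, α m * β m * u + α m * γ m * v + β m * γ m * w = 0 := by
    intro m
    have := hz (m.natAdd 3)
    change cq c (p (m.natAdd 3)) = 0 at this
    rw [hco, cq_three, show cq c x = 0 from hz 0, show cq c a = 0 from hz 1,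
      show cq c b = 0 from hz 2] at this
    linear_combination this
  have hpar := fun m => param_point x a b _ (α m) (β m) (γ m) u v w (hβ m) (hγ m) hw0
    (hco m) (hcon m)
  let φ : ℂ → Pt := fun t => (-(t * w)) • x + (u + t * v) • a + (t * (u + t * v)) • b
  let V : Fin 3 → Polynomial ℂ := fun m =>
    Polynomial.C (v * b m) * Polynomial.X ^ 2
      + Polynomial.C (-w * x m + v * a m + u * b m) * Polynomial.X + Polynomial.C (u * a m)
  have hVd : ∀ m, (V m).natDegree ≤ 2 := fun m => Polynomial.natDegree_quadratic_le
  have hVe : ∀ t, (fun m => (V m).eval t) = φ t := by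
    intro t; ext m; simp [V, φ]; ring
  have hVc : (fun m => (V m).coeff 2) = v • b := by
    ext m
    simp only [V, Polynomial.coeff_add, Polynomial.coeff_C_mul]
    simp [Polynomial.coeff_X, Polynomial.coeff_C]
  let τ : Fin 4 → ℂ := fun m => γ m / β m
  have hτ : Function.Injective τ := by
    intro m n hmn
    by_contra hne
    apply h3 0 (m.natAdd 3) (n.natAdd 3) (hge m).1.symm (hge n).1.symm
      (fun h => hne (Fin.natAdd_injective _ _ h))
    have h5 : γ m * β n - β m * γ n = 0 := by
      have : γ m / β m = γ n / β n := hmn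
      rw [div_eq_div_iff (hβ m) (hβ n)] at this
      linear_combination this
    rw [hco, hco]
    have : det3 x (α m • x + β m • a + γ m • b) (α n • x + β n • a + γ n • b)
        = -(γ m * β n - β m * γ n) * det3 x a b := by
      simp only [det3, Pi.add_apply, Pi.smul_apply, smul_eq_mul]; ring
    rw [← hx, this, h5]; ring
  have key : ∀ E : MvPolynomial (Fin 3) ℂ, E.IsHomogeneous 3 →
      (∀ m, MvPolynomial.eval (P m) E = 0) → ∀ t : ℂ, MvPolynomial.eval (φ t) E = 0 := by
    intro E hE hzE t
    have hzp : ∀ m, MvPolynomial.eval (p m) E = 0 := fun m => hzE _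
    rw [← hVe]
    apply aux_vanish E hE V hVd (insert 0 (insert (-u / v) (Finset.univ.image τ)))
    · rw [Finset.card_insert_of_notMem, Finset.card_insert_of_notMem,
        Finset.card_image_of_injective _ hτ]
      · simp
      · simp only [Finset.mem_image, Finset.mem_univ, true_and, not_exists]
        intro m hm
        apply (hpar m).1
        change u + τ m * v = 0
        rw [hm]; field_simp; ring
      · simp only [Finset.mem_insert, Finset.mem_image, Finset.mem_univ, true_and, not_or,
          not_exists]
        refine ⟨(div_ne_zero (neg_ne_zero.mpr hu0) hv0).symm, fun m => ?_⟩
        exact div_ne_zero (hγ m) (hβ m)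
    · intro s hs
      rw [hVe]
      simp only [Finset.mem_insert, Finset.mem_image, Finset.mem_univ, true_and] at hs
      rcases hs with rfl | rfl | ⟨m, rfl⟩
      · have : φ 0 = u • a := by simp [φ]
        rw [this, aux_scale E hE, hzp, mul_zero]
      · have h6 : u + -u / v * v = 0 := by field_simp; ring
        have : φ (-u / v) = (-(-u / v * w)) • x := by
          simp only [φ]; rw [h6]; simp
        rw [this, aux_scale E hE, hzp, mul_zero]
      · have : φ (τ m) = _ := (hpar m).2
        rw [this, aux_scale E hE, hzp, mul_zero]
    · rw [hVc, aux_scale E hE, hzp, mul_zero]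
  have ind := det3_comb x a b hbas
  have : Infinite {t : ℂ // u + t * v ≠ 0} := by
    have hfin : ({-u / v} : Set ℂ).Finite := Set.finite_singleton _
    have := hfin.infinite_compl.to_subtype
    refine Infinite.of_injective
      (fun t : ↥(({-u / v} : Set ℂ)ᶜ) => (⟨t.1, fun h => t.2 ?_⟩ : {t : ℂ // u + t * v ≠ 0})) ?_
    · rw [Set.mem_singleton_iff, eq_div_iff hv0]; linear_combination h
    · intro s t h
      exact Subtype.ext (congrArg (fun z => z.1) h)
  refine aux_pigeon F G P hint (fun t : {t : ℂ // u + t * v ≠ 0} => φ t.1) ?_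
    (fun t => key F hFhom (fun m => (hPz m).1) t.1)
    (fun t => key G hGhom (fun m => (hPz m).2) t.1) ?_
  · intro t ht
    exact t.2 (ind _ _ _ ht).2.1
  · rintro ⟨s, hs⟩ ⟨t, ht⟩ k h
    have := ind (-(s * w) - k * -(t * w)) ((u + s * v) - k * (u + t * v))
      (s * (u + s * v) - k * (t * (u + t * v))) (by
      have h' := sub_eq_zero.mpr h
      rw [← h']; simp only [φ, sub_smul, smul_add, mul_smul]; abel)
    apply Subtype.ext
    change s = t
    have : (s - t) * (u + s * v) = 0 := by linear_combination this.2.2 - t * this.2.1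
    exact sub_eq_zero.mp ((mul_eq_zero.mp this).resolve_right hs)

/-! ### Dimension counts -/

theorem ker_one {V : Type} [AddCommGroup V] [Module ℂ V] [FiniteDimensional ℂ V] {n : ℕ}
    (hV : Module.finrank ℂ V = n + 1) (ev : V →ₗ[ℂ] (Fin n → ℂ))
    (h : ∀ i, ∃ v, ev v i ≠ 0 ∧ ∀ j, j ≠ i → ev v j = 0) :
    Module.finrank ℂ (LinearMap.ker ev) = 1 := by
  choose v hv hv' using h
  have hs : LinearMap.range ev = ⊤ := by
    rw [LinearMap.range_eq_top]
    intro y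
    refine ⟨∑ i, (y i / ev (v i) i) • v i, ?_⟩
    ext j
    rw [map_sum, Finset.sum_apply, Finset.sum_eq_single j]
    · simp [hv j]
    · intro i _ hij
      simp [hv' i j hij.symm]
    · simp
  have := LinearMap.finrank_range_add_finrank_ker ev
  rw [hs, finrank_top, hV, Module.finrank_fin_fun] at this
  omega

theorem ker_prop {V : Type} [AddCommGroup V] [Module ℂ V] [FiniteDimensional ℂ V] {n : ℕ}
    (hV : Module.finrank ℂ V = n + 1) (ev : V →ₗ[ℂ] (Fin n → ℂ))
    (h : ∀ i, ∃ v, ev v i ≠ 0 ∧ ∀ j, j ≠ i → ev v j = 0)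
    (x y : V) (hx : ev x = 0) (hy : ev y = 0) (hy0 : y ≠ 0) : ∃ k : ℂ, x = k • y := by
  have h1 := ker_one hV ev h
  obtain ⟨k, hk⟩ := (finrank_eq_one_iff_of_nonzero' (⟨y, hy⟩ : LinearMap.ker ev)
    (fun h0 => hy0 (congrArg Subtype.val h0))).mp h1 ⟨x, hx⟩
  exact ⟨k, (congrArg Subtype.val hk).symm⟩

/-- Evaluation of conics at points, as a linear map. -/
def cqL {n : ℕ} (p : Fin n → Pt) : (Fin 6 → ℂ) →ₗ[ℂ] (Fin n → ℂ) where
  toFun c := fun i => cq c (p i)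
  map_add' c d := by ext i; simp only [cq, Pi.add_apply]; ring
  map_smul' k c := by
    ext i; simp only [cq, Pi.smul_apply, smul_eq_mul, RingHom.id_apply]; ring

/-- The value of a linear form. -/
def lin (l v : Pt) : ℂ := l 0 * v 0 + l 1 * v 1 + l 2 * v 2

theorem lin_cp (p q v : Pt) : lin (cp p q) v = det3 p q v := by
  simp [lin, cp, det3]; ring

/-- The coefficients of the product of two lines. -/
def lprod (l m : Pt) : Fin 6 → ℂ :=
  ![l 0 * m 0, l 1 * m 1, l 2 * m 2, l 0 * m 1 + l 1 * m 0, l 0 * m 2 + l 2 * m 0,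
    l 1 * m 2 + l 2 * m 1]

theorem cq_lprod (l m v : Pt) : cq (lprod l m) v = lin l v * lin m v := by
  simp [cq, lprod, lin]; ring

theorem det3_rot (p q r : Pt) : det3 q r p = det3 p q r := by
  simp only [det3]; ring

theorem det3_swap (p q r : Pt) : det3 p r q = - det3 p q r := by
  simp only [det3]; ring

theorem det3_same_left (p q : Pt) : det3 p q p = 0 := by
  simp only [det3]; ring

theorem det3_same_right (p q : Pt) : det3 p q q = 0 := by
  simp only [det3]; ring

/-- Four points can be separated from a fifth by a pair of lines. -/
theorem conic_sep (p : Fin 5 → Pt)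
    (h4 : ∀ i j k l, i ≠ j → i ≠ k → i ≠ l → j ≠ k → j ≠ l → k ≠ l →
      det3 (p i) (p j) (p k) = 0 → det3 (p i) (p j) (p l) = 0 → False)
    (i : Fin 5) : ∃ c, cqL p c i ≠ 0 ∧ ∀ j, j ≠ i → cqL p c j = 0 := by
  have hi : ∀ m, i.succAbove m ≠ i := fun m => Fin.succAbove_ne i m
  have hne : ∀ m n, m ≠ n → i.succAbove m ≠ i.succAbove n := fun m n h h' =>
    h (Fin.succAbove_right_injective h')
  -- two distinct lines through a point cannot both contain `p i`
  have no : ∀ a b c : Fin 4, a ≠ b → a ≠ c → b ≠ c →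
      det3 (p (i.succAbove a)) (p (i.succAbove b)) (p i) = 0 →
      det3 (p (i.succAbove a)) (p (i.succAbove c)) (p i) = 0 → False := by
    intro a b c hab hac hbc h1 h2
    refine h4 (i.succAbove a) i (i.succAbove b) (i.succAbove c) (hi _) (hne _ _ hab)
      (hne _ _ hac) (hi _).symm (hi _).symm (hne _ _ hbc) ?_ ?_
    · rw [det3_swap, h1, neg_zero]
    · rw [det3_swap, h2, neg_zero]
  have sw : ∀ a b : Fin 4, det3 (p (i.succAbove a)) (p (i.succAbove b)) (p i) = 0 →
      det3 (p (i.succAbove b)) (p (i.succAbove a)) (p i) = 0 := by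
    intro a b h
    rw [← det3_rot, det3_swap, h, neg_zero]
  have build : ∀ a b c d : Fin 4, (∀ m, m = a ∨ m = b ∨ m = c ∨ m = d) →
      det3 (p (i.succAbove a)) (p (i.succAbove b)) (p i)
        * det3 (p (i.succAbove c)) (p (i.succAbove d)) (p i) ≠ 0 →
      ∃ c, cqL p c i ≠ 0 ∧ ∀ j, j ≠ i → cqL p c j = 0 := by
    intro a b c d hall h
    refine ⟨lprod (cp (p (i.succAbove a)) (p (i.succAbove b)))
      (cp (p (i.succAbove c)) (p (i.succAbove d))), ?_, ?_⟩
    · change cq _ _ ≠ 0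
      rw [cq_lprod, lin_cp, lin_cp]; exact h
    · intro j hj
      change cq _ _ = 0
      rw [cq_lprod, lin_cp, lin_cp]
      obtain ⟨m, rfl⟩ := Fin.exists_succAbove_eq hj
      rcases hall m with rfl | rfl | rfl | rfl
      · rw [det3_same_left, zero_mul]
      · rw [det3_same_right, zero_mul]
      · rw [det3_same_left, mul_zero]
      · rw [det3_same_right, mul_zero]
  by_cases h1 : det3 (p (i.succAbove 0)) (p (i.succAbove 1)) (p i)
        * det3 (p (i.succAbove 2)) (p (i.succAbove 3)) (p i) = 0
  · by_cases h2 : det3 (p (i.succAbove 0)) (p (i.succAbove 2)) (p i)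
        * det3 (p (i.succAbove 1)) (p (i.succAbove 3)) (p i) = 0
    · exfalso
      rcases mul_eq_zero.mp h1 with h1 | h1 <;> rcases mul_eq_zero.mp h2 with h2 | h2
      · exact no 0 1 2 (by decide) (by decide) (by decide) h1 h2
      · exact no 1 0 3 (by decide) (by decide) (by decide) (sw _ _ h1) h2
      · exact no 2 3 0 (by decide) (by decide) (by decide) h1 (sw _ _ h2)
      · exact no 3 2 1 (by decide) (by decide) (by decide) (sw _ _ h1) (sw _ _ h2)
    · exact build 0 2 1 3 (by decide) h2
  · exact build 0 1 2 3 (by decide) h1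

/-- Through five points passes a conic. -/
theorem conic_exists (p : Fin 5 → Pt) : ∃ c : Fin 6 → ℂ, c ≠ 0 ∧ ∀ i, cq c (p i) = 0 := by
  have : LinearMap.ker (cqL p) ≠ ⊥ := LinearMap.ker_ne_bot_of_finrank_lt (by simp)
  obtain ⟨c, hc, hc0⟩ := Submodule.exists_mem_ne_zero_of_ne_bot this
  exact ⟨c, hc0, fun i => congrFun (LinearMap.mem_ker.mp hc) i⟩

/-- The product of a line and a conic. -/
theorem line_conic (l : Pt) (c : Fin 6 → ℂ) : ∃ K : MvPolynomial (Fin 3) ℂ,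
    K.IsHomogeneous 3 ∧ ∀ v, MvPolynomial.eval v K = lin l v * cq c v := by
  have hX : ∀ i : Fin 3, (MvPolynomial.X i : MvPolynomial (Fin 3) ℂ).IsHomogeneous 1 :=
    fun i => MvPolynomial.isHomogeneous_X _ _
  have h1 : ∀ (a : ℂ) (i : Fin 3), (MvPolynomial.C a * MvPolynomial.X i :
      MvPolynomial (Fin 3) ℂ).IsHomogeneous 1 := fun a i => (hX i).C_mul a
  have h2 : ∀ (a : ℂ) (i j : Fin 3), (MvPolynomial.C a * (MvPolynomial.X i * MvPolynomial.X j) :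
      MvPolynomial (Fin 3) ℂ).IsHomogeneous 2 := fun a i j => ((hX i).mul (hX j)).C_mul a
  refine ⟨_, (((h1 (l 0) 0).add (h1 (l 1) 1)).add (h1 (l 2) 2)).mul
    ((((((h2 (c 0) 0 0).add (h2 (c 1) 1 1)).add (h2 (c 2) 2 2)).add (h2 (c 3) 0 1)).add
      (h2 (c 4) 0 2)).add (h2 (c 5) 1 2)), fun v => ?_⟩
  simp only [lin, cq, map_mul, map_add, MvPolynomial.eval_C, MvPolynomial.eval_X]; ring

theorem cubic_sep_aux (P : Fin 9 → Pt)
    (h4 : ∀ i j k l, i ≠ j → i ≠ k → i ≠ l → j ≠ k → j ≠ l → k ≠ l →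
      det3 (P i) (P j) (P k) = 0 → det3 (P i) (P j) (P l) = 0 → False)
    (h7 : ∀ σ : Fin 7 → Fin 9, Function.Injective σ → ∀ c : Fin 6 → ℂ, c ≠ 0 →
      (∀ i, cq c (P (σ i)) = 0) → False)
    (σ : Fin 8 → Fin 9) (hσ : Function.Injective σ)
    (hd1 : det3 (P (σ 0)) (P (σ 1)) (P (σ 7)) ≠ 0)
    (hd2 : det3 (P (σ 0)) (P (σ 2)) (P (σ 7)) ≠ 0) :
    ∃ K : MvPolynomial (Fin 3) ℂ, K.IsHomogeneous 3 ∧ MvPolynomial.eval (P (σ 7)) K ≠ 0 ∧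
      ∀ j, j ≠ 7 → MvPolynomial.eval (P (σ j)) K = 0 := by
  by_contra hno
  obtain ⟨c, hc, hcz⟩ := conic_exists (fun i => P (σ ((![2, 3, 4, 5, 6] : Fin 5 → Fin 8) i)))
  obtain ⟨d, hd, hdz⟩ := conic_exists (fun i => P (σ ((![1, 3, 4, 5, 6] : Fin 5 → Fin 8) i)))
  have hc7 : cq c (P (σ 7)) = 0 := by
    by_contra h
    obtain ⟨K, hK, hKe⟩ := line_conic (cp (P (σ 0)) (P (σ 1))) c
    refine hno ⟨K, hK, ?_, ?_⟩
    · rw [hKe, lin_cp]; exact mul_ne_zero hd1 h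
    · intro j hj
      rw [hKe, lin_cp]
      have : j = 0 ∨ j = 1 ∨ ∃ i, (![2, 3, 4, 5, 6] : Fin 5 → Fin 8) i = j := by
        revert j; decide
      rcases this with rfl | rfl | ⟨i, rfl⟩
      · rw [det3_same_left, zero_mul]
      · rw [det3_same_right, zero_mul]
      · rw [hcz, mul_zero]
  have hd7 : cq d (P (σ 7)) = 0 := by
    by_contra h
    obtain ⟨K, hK, hKe⟩ := line_conic (cp (P (σ 0)) (P (σ 2))) d
    refine hno ⟨K, hK, ?_, ?_⟩
    · rw [hKe, lin_cp]; exact mul_ne_zero hd2 h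
    · intro j hj
      rw [hKe, lin_cp]
      have : j = 0 ∨ j = 2 ∨ ∃ i, (![1, 3, 4, 5, 6] : Fin 5 → Fin 8) i = j := by
        revert j; decide
      rcases this with rfl | rfl | ⟨i, rfl⟩
      · rw [det3_same_left, zero_mul]
      · rw [det3_same_right, zero_mul]
      · rw [hdz, mul_zero]
  have hτ : Function.Injective (![3, 4, 5, 6, 7] : Fin 5 → Fin 8) := by decide
  obtain ⟨k, hk⟩ := ker_prop (n := 5) (by simp)
    (cqL (fun i => P (σ ((![3, 4, 5, 6, 7] : Fin 5 → Fin 8) i))))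
    (conic_sep _ (by
      intro i j k l hij hik hil hjk hjl hkl
      exact h4 _ _ _ _ (hσ.ne (hτ.ne hij)) (hσ.ne (hτ.ne hik)) (hσ.ne (hτ.ne hil))
        (hσ.ne (hτ.ne hjk)) (hσ.ne (hτ.ne hjl)) (hσ.ne (hτ.ne hkl)))) c d
    (by
      ext i
      fin_cases i
      exacts [hcz 1, hcz 2, hcz 3, hcz 4, hc7])
    (by
      ext i
      fin_cases i
      exacts [hdz 1, hdz 2, hdz 3, hdz 4, hd7]) hd
  have hc1 : cq c (P (σ 1)) = 0 := by
    have h0 : cq d (P (σ 1)) = 0 := hdz 0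
    have : cq c (P (σ 1)) = k * cq d (P (σ 1)) := by
      rw [hk]; simp only [cq, Pi.smul_apply, smul_eq_mul]; ring
    rw [this, h0, mul_zero]
  have hρ : Function.Injective (![1, 2, 3, 4, 5, 6, 7] : Fin 7 → Fin 8) := by decide
  refine h7 (fun i => σ ((![1, 2, 3, 4, 5, 6, 7] : Fin 7 → Fin 8) i)) (hσ.comp hρ) c hc ?_
  intro i
  fin_cases i
  exacts [hc1, hcz 0, hcz 1, hcz 2, hcz 3, hcz 4, hc7]

theorem cubic_sep (P : Fin 9 → Pt)
    (h4 : ∀ i j k l, i ≠ j → i ≠ k → i ≠ l → j ≠ k → j ≠ l → k ≠ l →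
      det3 (P i) (P j) (P k) = 0 → det3 (P i) (P j) (P l) = 0 → False)
    (h7 : ∀ σ : Fin 7 → Fin 9, Function.Injective σ → ∀ c : Fin 6 → ℂ, c ≠ 0 →
      (∀ i, cq c (P (σ i)) = 0) → False)
    (σ : Fin 8 → Fin 9) (hσ : Function.Injective σ) :
    ∃ K : MvPolynomial (Fin 3) ℂ, K.IsHomogeneous 3 ∧ MvPolynomial.eval (P (σ 7)) K ≠ 0 ∧
      ∀ j, j ≠ 7 → MvPolynomial.eval (P (σ j)) K = 0 := by
  have two : ∀ j k : Fin 8, j ≠ 0 → j ≠ 7 → k ≠ 0 → k ≠ 7 → j ≠ k →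
      det3 (P (σ 0)) (P (σ j)) (P (σ 7)) = 0 → det3 (P (σ 0)) (P (σ k)) (P (σ 7)) ≠ 0 := by
    intro j k hj0 hj7 hk0 hk7 hjk h1 h2
    refine h4 (σ 0) (σ 7) (σ j) (σ k) (hσ.ne (by decide)) (hσ.ne hj0.symm) (hσ.ne hk0.symm)
      (hσ.ne hj7.symm) (hσ.ne hk7.symm) (hσ.ne hjk) ?_ ?_
    · rw [det3_swap, h1, neg_zero]
    · rw [det3_swap, h2, neg_zero]
  have perm : ∀ s : Equiv.Perm (Fin 8), s 0 = 0 → s 7 = 7 →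
      det3 (P (σ 0)) (P (σ (s 1))) (P (σ 7)) ≠ 0 → det3 (P (σ 0)) (P (σ (s 2))) (P (σ 7)) ≠ 0 →
      ∃ K : MvPolynomial (Fin 3) ℂ, K.IsHomogeneous 3 ∧ MvPolynomial.eval (P (σ 7)) K ≠ 0 ∧
      ∀ j, j ≠ 7 → MvPolynomial.eval (P (σ j)) K = 0 := by
    intro s s0 s7 h1 h2
    obtain ⟨K, hK, hK7, hKj⟩ := cubic_sep_aux P h4 h7 (fun i => σ (s i)) (hσ.comp s.injective)
      (by simpa only [s0, s7] using h1) (by simpa only [s0, s7] using h2)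
    refine ⟨K, hK, by simpa only [s7] using hK7, fun j hj => ?_⟩
    have := hKj (s.symm j) (fun h => hj (by rw [← s7, ← h, Equiv.apply_symm_apply]))
    simpa only [Equiv.apply_symm_apply] using this
  by_cases h1 : det3 (P (σ 0)) (P (σ 1)) (P (σ 7)) = 0
  · exact perm (Equiv.swap 1 3) (by decide) (by decide)
      (two 1 3 (by decide) (by decide) (by decide) (by decide) (by decide) h1)
      (two 1 2 (by decide) (by decide) (by decide) (by decide) (by decide) h1)
  by_cases h2 : det3 (P (σ 0)) (P (σ 2)) (P (σ 7)) = 0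
  · exact perm (Equiv.swap 2 3) (by decide) (by decide)
      (two 2 1 (by decide) (by decide) (by decide) (by decide) (by decide) h2)
      (two 2 3 (by decide) (by decide) (by decide) (by decide) (by decide) h2)
  exact perm 1 rfl rfl h1 h2

/-- The space of cubic forms. -/
abbrev Cub : Type := MvPolynomial.homogeneousSubmodule (Fin 3) ℂ 3

theorem cub_finrank : FiniteDimensional ℂ Cub ∧ Module.finrank ℂ Cub = 9 + 1 := by
  have hs : {d : Fin 3 →₀ ℕ | d.degree = 3} = ↑(Finset.finsuppAntidiag (Finset.univ : Finset (Fin 3)) 3) := by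
    ext d
    simp [Finsupp.degree_eq_sum]
  let e : Cub ≃ₗ[ℂ] (↥(Finset.finsuppAntidiag (Finset.univ : Finset (Fin 3)) 3) →₀ ℂ) :=
    (LinearEquiv.ofEq _ _ (by
      rw [MvPolynomial.homogeneousSubmodule_eq_finsupp_supported, hs])).trans
      (AddMonoidAlgebra.supportedEquivFinsupp _)
  refine ⟨Module.Finite.equiv e.symm, ?_⟩
  rw [e.finrank_eq, Module.finrank_finsupp_self, Fintype.card_coe]
  decide

/-- Evaluation of cubics at the nine points. -/
def cubL (P : Fin 9 → Pt) : Cub →ₗ[ℂ] (Fin 9 → ℂ) where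
  toFun K := fun i => MvPolynomial.eval (P i) K.1
  map_add' c d := by ext i; simp
  map_smul' k c := by ext i; simp

/-- **Chasles / Cayley–Bacharach.** If two plane cubics meet set-theoretically in
exactly nine distinct points `P 0, …, P 8` and a third cubic passes through the
first eight of them, then it also passes through the ninth. -/
theorem chasles (F G H : MvPolynomial (Fin 3) ℂ)
    (hF : F ≠ 0) (hG : G ≠ 0) (hH : H ≠ 0)
    (hFhom : F.IsHomogeneous 3) (hGhom : G.IsHomogeneous 3) (hHhom : H.IsHomogeneous 3)
    (P : Fin 9 → Pt) (hP0 : ∀ i, P i ≠ 0)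
    (hPdist : ∀ i j, i ≠ j → ¬ projEq (P i) (P j))
    (hint : ∀ v : Pt, v ≠ 0 →
      ((MvPolynomial.eval v F = 0 ∧ MvPolynomial.eval v G = 0) ↔ ∃ i, projEq (P i) v))
    (hH8 : ∀ i : Fin 9, i ≠ 8 → MvPolynomial.eval (P i) H = 0) :
    MvPolynomial.eval (P 8) H = 0 := by
  by_contra hne
  have hPz : ∀ i, MvPolynomial.eval (P i) F = 0 ∧ MvPolynomial.eval (P i) G = 0 := fun i =>
    (hint (P i) (hP0 i)).mpr ⟨i, 1, one_ne_zero, (one_smul _ _).symm⟩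
  have h4 := no_four F G hFhom hGhom P hP0 hPdist hint
  have h7 := no_seven F G hFhom hGhom P hP0 hPdist hint
  have hsep : ∀ i, ∃ K : Cub, cubL P K i ≠ 0 ∧ ∀ j, j ≠ i → cubL P K j = 0 := by
    intro i
    by_cases hi : i = 8
    · subst hi
      exact ⟨⟨H, hHhom⟩, hne, fun j hj => hH8 j hj⟩
    obtain ⟨i', rfl⟩ : ∃ i' : Fin 8, i'.castSucc = i := Fin.exists_castSucc_eq.mpr hi
    obtain ⟨K, hK, hK7, hKj⟩ := cubic_sep P h4 h7 (fun m => (Equiv.swap 7 i' m).castSucc)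
      ((Fin.castSucc_injective 8).comp (Equiv.injective _))
    rw [Equiv.swap_apply_left] at hK7
    have hKz : ∀ j : Fin 8, j ≠ i' → MvPolynomial.eval (P j.castSucc) K = 0 := by
      intro j hj
      have := hKj (Equiv.swap 7 i' j) (fun h => hj (by
        have h' := congrArg (Equiv.swap 7 i') h
        rwa [Equiv.swap_apply_left, Equiv.swap_apply_self] at h'))
      simpa using this
    let K' : Cub := ⟨K, hK⟩ - (MvPolynomial.eval (P 8) K / MvPolynomial.eval (P 8) H) •
      (⟨H, hHhom⟩ : Cub)
    have hK' : ∀ j, cubL P K' j = MvPolynomial.eval (P j) K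
        - MvPolynomial.eval (P 8) K / MvPolynomial.eval (P 8) H * MvPolynomial.eval (P j) H := by
      intro j; simp [K', cubL]
    refine ⟨K', ?_, ?_⟩
    · rw [hK', hH8 _ hi, mul_zero, sub_zero]; exact hK7
    · intro j hj
      rw [hK']
      by_cases hj8 : j = 8
      · subst hj8
        rw [div_mul_cancel₀ _ hne, sub_self]
      · obtain ⟨j', rfl⟩ : ∃ j' : Fin 8, j'.castSucc = j := Fin.exists_castSucc_eq.mpr hj8
        rw [hH8 _ hj8, mul_zero, sub_zero]
        exact hKz j' (fun h => hj (by rw [h]))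
  have hfd := cub_finrank.1
  obtain ⟨k, hk⟩ := ker_prop cub_finrank.2 (cubL P) hsep ⟨F, hFhom⟩ ⟨G, hGhom⟩
    (funext fun i => (hPz i).1) (funext fun i => (hPz i).2)
    (fun h => hG (congrArg Subtype.val h))
  exact not_prop F G hG hGhom P hint k (congrArg Subtype.val hk)

end PappusPaper
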